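/- arXiv:2006.09317 — 2 statements merged into one kernel-verified Lean document; each statement's English description precedes it below -/
import Mathlib

section
/- Let A be a unital C*-algebra, let a ∈ A be a selfadjoint element whose spectrum is contained in {0} ∪ [ε, ∞) for some ε > 0, and let p ∈ A be a projection with a·p = p·a = 0 and a + p invertible. Then for every unital *-homomorphism π : A → B(H), where H is a complex Hilbert space, the operator π(p) is the orthogonal projection of H onto the kernel of π(a); in particular the range of π(p) equals ker π(a). -/
/-- If `p` is an idempotent with `a * p = 0` and `a + p` is invertible, then `1 - p` is a left
multiple of `a`. -/
theorem exists_mul_eq_one_sub_of_isUnit_add {R : Type*} [Ring R] {a p : R}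
    (hp : p * p = p) (hap : a * p = 0) (hinv : IsUnit (a + p)) : ∃ b, b * a = 1 - p := by
  obtain ⟨b, hb⟩ := hinv.exists_left_inv
  refine ⟨b, ?_⟩
  calc b * a = b * ((a + p) * (1 - p)) := by
        rw [mul_sub, mul_one, add_mul, hap, hp, zero_add, add_sub_cancel_right]
    _ = 1 - p := by rw [← mul_assoc, hb, one_mul]

/-- Let `a` be a selfadjoint element of a unital C*-algebra with spectrum in
`{0} ∪ [ε, ∞)`, and let `p` be the spectral projection of `a` at `0` (the projection with
`a * p = p * a = 0` and `a + p` invertible).  Then for every unital *-homomorphism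
`π : A → B(H)`, the operator `π p` is the orthogonal projection of `H` onto `ker (π a)`:
its range is `ker (π a)`, it fixes `ker (π a)` pointwise, and for every `v` the vector
`v - π p v` is orthogonal to `ker (π a)`. -/
theorem stmt_2 {A : Type*} [CStarAlgebra A] {H : Type*}
    [NormedAddCommGroup H] [InnerProductSpace ℂ H] [CompleteSpace H]
    (a p : A) (ha : IsSelfAdjoint a)
    (ε : ℝ) (hε : 0 < ε) (hspec : spectrum ℝ a ⊆ {0} ∪ Set.Ici ε)
    (hp_star : star p = p) (hp_idem : p * p = p)
    (hap : a * p = 0) (hpa : p * a = 0) (hinv : IsUnit (a + p))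
    (π : A →⋆ₐ[ℂ] (H →L[ℂ] H)) :
    LinearMap.range (π p : H →ₗ[ℂ] H) = LinearMap.ker (π a : H →ₗ[ℂ] H) ∧
    (∀ v ∈ LinearMap.ker (π a : H →ₗ[ℂ] H), π p v = v) ∧
    (∀ v : H, ∀ w ∈ LinearMap.ker (π a : H →ₗ[ℂ] H), (inner ℂ (v - π p v) w : ℂ) = 0) := by
  obtain ⟨b, hb⟩ := exists_mul_eq_one_sub_of_isUnit_add hp_idem hap hinv
  have hfix : ∀ v ∈ LinearMap.ker (π a : H →ₗ[ℂ] H), π p v = v := by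
    intro v hv
    have hv0 : π a v = 0 := hv
    have h : π b (π a v) = v - π p v := by
      simpa using DFunLike.congr_fun (congrArg π hb) v
    rw [hv0, map_zero] at h
    exact (sub_eq_zero.mp h.symm).symm
  refine ⟨le_antisymm ?_ fun v hv ↦ ⟨v, hfix v hv⟩, hfix, fun v w hw ↦ ?_⟩
  · rintro _ ⟨v, rfl⟩
    show π a (π p v) = 0
    simpa using DFunLike.congr_fun (congrArg π hap) v
  · have hadj : ContinuousLinearMap.adjoint (π p) = π p := by
      rw [← ContinuousLinearMap.star_eq_adjoint, ← map_star, hp_star]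
    have h : inner ℂ (π p v) w = inner ℂ v w := by
      rw [← hadj, ContinuousLinearMap.adjoint_inner_left, hfix w hw]
    rw [inner_sub_left, h, sub_self]
end

section
/- Let G be a group, let S ⊆ G be a finite symmetric generating set (s ∈ S implies s⁻¹ ∈ S, and S generates G), and let π be a unitary representation of G on a complex Hilbert space H. Consider the bounded operator Δ₀ = Σ_{s∈S} (2·Id − π(s) − π(s⁻¹)) on H. Then ker Δ₀ = {v ∈ H : π(g)v = v for all g ∈ G}, the subspace of G-invariant vectors of π. -/
/-- For a unitary representation `π`, the quadratic form of `2·Id - π g - π g⁻¹` at `v` is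
`‖π g v - v‖ ^ 2`. -/
theorem inner_two_smul_sub_sub_inv_apply {G : Type*} [Group G] {H : Type*}
    [NormedAddCommGroup H] [InnerProductSpace ℂ H] [CompleteSpace H]
    (π : G →* (H →L[ℂ] H)) (hπ : ∀ g : G, ContinuousLinearMap.adjoint (π g) = π g⁻¹)
    (g : G) (v : H) :
    inner ℂ v (((2 : ℂ) • ContinuousLinearMap.id ℂ H - π g - π g⁻¹) v) =
      ((‖π g v - v‖ ^ 2 : ℝ) : ℂ) := by
  have hinv : π g⁻¹ (π g v) = v := by
    rw [← mul_apply_eq_comp, ← map_mul, inv_mul_cancel, map_one,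
      one_apply_eq_self]
  have hnorm : inner ℂ (π g v) (π g v) = inner ℂ v v := by
    rw [← ContinuousLinearMap.adjoint_inner_right, hπ, hinv]
  have hadj : inner ℂ v (π g⁻¹ v) = inner ℂ (π g v) v := by
    rw [← hπ, ContinuousLinearMap.adjoint_inner_right]
  have hsq : ((‖π g v - v‖ ^ 2 : ℝ) : ℂ) = inner ℂ (π g v - v) (π g v - v) := by
    rw [inner_self_eq_norm_sq_to_K]
    push_cast
    rfl
  rw [hsq]
  simp only [sub_apply, smul_apply, ContinuousLinearMap.id_apply, inner_sub_left,
    inner_sub_right, inner_smul_right, hnorm, hadj]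
  ring

/-- A vector fixed by a generating set is fixed by the whole group. -/
theorem apply_eq_self_of_closure_eq_top {G : Type*} [Group G] {H : Type*}
    [NormedAddCommGroup H] [InnerProductSpace ℂ H] {S : Set G}
    (hgen : Subgroup.closure S = ⊤) (π : G →* (H →L[ℂ] H)) {v : H}
    (hv : ∀ s ∈ S, π s v = v) (g : G) : π g v = v := by
  have hg : g ∈ Subgroup.closure S := hgen ▸ Subgroup.mem_top g
  induction hg using Subgroup.closure_induction with
  | mem s hs => exact hv s hs
  | one => rw [map_one, one_apply_eq_self]
  | mul x y _ _ hx hy => rw [map_mul, mul_apply_eq_comp, hy, hx]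
  | inv x _ hx =>
    nth_rewrite 1 [← hx]
    rw [← mul_apply_eq_comp, ← map_mul, inv_mul_cancel, map_one,
      one_apply_eq_self]

/-- Let `G` be a group with a finite symmetric generating set `S`, and let
`π` be a unitary representation of `G` on a complex Hilbert space `H` (unitarity being
expressed by `(π g)* = π g⁻¹`).  The kernel of the degree-0 Laplacian
`Δ₀ = ∑_{s ∈ S} (2·Id - π s - π s⁻¹)` is exactly the subspace of `G`-invariant vectors. -/
theorem stmt_9 {G : Type*} [Group G] {H : Type*}
    [NormedAddCommGroup H] [InnerProductSpace ℂ H] [CompleteSpace H]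
    (S : Finset G) (hsymm : ∀ s ∈ S, s⁻¹ ∈ S) (hgen : Subgroup.closure (S : Set G) = ⊤)
    (π : G →* (H →L[ℂ] H)) (hπ : ∀ g : G, ContinuousLinearMap.adjoint (π g) = π g⁻¹) :
    (LinearMap.ker ((∑ s ∈ S, ((2 : ℂ) • ContinuousLinearMap.id ℂ H - π s - π s⁻¹) :
        H →L[ℂ] H) : H →ₗ[ℂ] H) : Set H)
      = {v : H | ∀ g : G, π g v = v} := by
  ext v
  simp only [SetLike.mem_coe, LinearMap.mem_ker, ContinuousLinearMap.coe_coe, Set.mem_ofPred_eq]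
  rw [sum_apply]
  constructor
  · intro hv
    refine apply_eq_self_of_closure_eq_top hgen π fun s hs => ?_
    have hsum : ∑ s ∈ S, ‖π s v - v‖ ^ 2 = 0 := by
      have h := congrArg (inner ℂ v) hv
      simp only [inner_sum, inner_two_smul_sub_sub_inv_apply π hπ, inner_zero_right] at h
      exact_mod_cast h
    have h := (Finset.sum_eq_zero_iff_of_nonneg fun _ _ => by positivity).1 hsum s hs
    exact sub_eq_zero.1 (norm_eq_zero.1 (pow_eq_zero_iff two_ne_zero |>.1 h))
  · intro hv
    refine Finset.sum_eq_zero fun s _ => ?_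
    simp [hv, two_smul]
end
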